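/- Let ω ∈ T1.2, so ω = C_i(F_k) with f_{k-1}−1 ≤ i ≤ f_k−1. Then the two gaps of ω are: ν_{ω,1} = C_j(F_{k-1}) where j ≡ i − f_{k-1} (mod f_{k-1}), of length f_{k-1} > 0 (separated case), and ν_{ω,2} = ε, the empty word (adjacent case: for those p, ω_p and ω_{p+1} are adjacent, i.e., ω² occurs). -/

import Mathlib

/-- Finite Fibonacci words: `Fw k = σ^k(a)` where `a = false`, `b = true`,
`σ(a) = ab`, `σ(b) = a`; so `Fw (k+2) = Fw (k+1) ++ Fw k`. -/
def Fw : ℕ → List Bool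
  | 0 => [false]
  | 1 => [false, true]
  | (k+2) => Fw (k+1) ++ Fw k

/-- The infinite Fibonacci word `F_∞` (0-indexed): since `Fw (n+1)` has length
`fib (n+3) > n`, its `n`-th letter is the `n`-th letter of `F_∞`. -/
def fw (n : ℕ) : Bool := (Fw (n+1)).getD n false

/-- Singular words, with index shifted by one: `sw n = s_{n-1}`.
`sw 0 = s_{-1} = a`, and `sw (n+1) = s_n = β_n · F_n · α_n⁻¹` where
`α_n` is the last letter of `F_n` and `β_n` the other letter. -/
def sw : ℕ → List Bool
  | 0 => [false]
  | (n+1) => (!((Fw n).getLastD false)) :: (Fw n).dropLast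

/-- The factor of `F_∞` of length `n` starting at (0-indexed) position `i`. -/
def seg (i n : ℕ) : List Bool := (List.range n).map (fun t => fw (i + t))

/-- `w` occurs in `F_∞` at (0-indexed) position `i`. -/
def OccursAt (w : List Bool) (i : ℕ) : Prop := seg i w.length = w

/-- `w` is a factor of `F_∞`. -/
def IsFactor (w : List Bool) : Prop := ∃ i, OccursAt w i

/-- Starting position of the `(p+1)`-st occurrence of `w` in `F_∞`
(occurrences enumerated by starting position, 0-indexed: `occPos w 0`
is the first occurrence, i.e. the paper's `ω_1`). -/
noncomputable def occPos (w : List Bool) (p : ℕ) : ℕ := Nat.nth (OccursAt w) p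

/-- A finite word viewed as an element of the free group on the alphabet. -/
def listToFree (w : List Bool) : FreeGroup Bool := (w.map FreeGroup.of).prod

/-- The gap `ν_{w,p}` (0-indexed in `p`: `gap w 0` is the paper's `ν_{w,1}`)
between the `(p+1)`-st and `(p+2)`-nd occurrences of `w`, as an element of the
free group: the separating word if the occurrences are separated or adjacent,
and the formal inverse of the overlap if they overlap. -/
noncomputable def gap (w : List Bool) (p : ℕ) : FreeGroup Bool :=
  if occPos w p + w.length ≤ occPos w (p+1) then
    listToFree (seg (occPos w p + w.length) (occPos w (p+1) - (occPos w p + w.length)))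
  else
    (listToFree (seg (occPos w (p+1)) (occPos w p + w.length - occPos w (p+1))))⁻¹

/-- The signed length `|ν_{w,p}|` of the gap (negative in the overlapped case). -/
noncomputable def gapLen (w : List Bool) (p : ℕ) : ℤ :=
  (occPos w (p+1) : ℤ) - ((occPos w p : ℤ) + (w.length : ℤ))

/-- `u` is a singular word (some `s_k`, `k ≥ -1`). -/
def IsSingular (u : List Bool) : Prop := ∃ n, u = sw n

/-- `u` is a singular kernel of `w`: a singular factor of `w` of maximal length. -/
def IsKernelOf (u w : List Bool) : Prop :=
  IsSingular u ∧ u <:+: w ∧ ∀ v : List Bool, IsSingular v → v <:+: w → v.length ≤ u.length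

/-- The excluded words `{ε, ab, ba, aba}`. -/
def excl : List (List Bool) := [[], [false, true], [true, false], [false, true, false]]

/-- The `i`-th conjugate `C_i(w)` (indices taken mod the length). -/
def conj (i : ℕ) (w : List Bool) : List Bool :=
  w.drop (i % w.length) ++ w.take (i % w.length)

/-- `sliceW u i j = u[i,j]`, the letters `i` through `j` of `u`, 1-indexed. -/
def sliceW (u : List Bool) (i j : ℕ) : List Bool := (u.take j).drop (i - 1)

theorem length_Fw : ∀ k, (Fw k).length = Nat.fib (k + 2)
  | 0 => rfl
  | 1 => rfl
  | k + 2 => by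
    rw [Fw, List.length_append, length_Fw (k + 1), length_Fw k, Nat.fib_add_two (n := k + 2)]
    exact add_comm _ _

theorem Fw_prefix_succ : ∀ k, Fw k <+: Fw (k + 1)
  | 0 => ⟨[true], rfl⟩
  | k + 1 => ⟨Fw k, rfl⟩

theorem Fw_prefix {k l : ℕ} (h : k ≤ l) : Fw k <+: Fw l := by
  induction l, h using Nat.le_induction with
  | base => exact List.prefix_rfl
  | succ l _ ih => exact ih.trans (Fw_prefix_succ l)

theorem lt_fib_add_three (t : ℕ) : t < Nat.fib (t + 3) := by
  induction t with
  | zero => decide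
  | succ t ih =>
    have h := Nat.fib_add_two (n := t + 2)
    have := Nat.fib_pos.2 (show 0 < t + 2 by omega)
    rw [show t + 1 + 3 = t + 2 + 2 by ring, h]
    rw [show t + 2 + 1 = t + 3 by ring]
    omega

/-- `Fw k` is a prefix of the infinite Fibonacci word. -/
theorem getElem_Fw {k t : ℕ} (h : t < (Fw k).length) : (Fw k)[t] = fw t := by
  have ht : t < (Fw (t + 1)).length := by
    rw [length_Fw]; exact lt_fib_add_three t
  rw [fw, List.getD_eq_getElem _ _ ht]
  rcases le_total k (t + 1) with hk | hk
  · exact (Fw_prefix hk).getElem h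
  · exact ((Fw_prefix hk).getElem ht).symm

theorem fw_zero : fw 0 = false := rfl

theorem fw_one : fw 1 = true := rfl

theorem fw_fib_add (k s : ℕ) (hs : s < Nat.fib (k + 2)) : fw (Nat.fib (k + 3) + s) = fw s := by
  have hl : Nat.fib (k + 3) + s < (Fw (k + 2)).length := by
    rw [length_Fw, Nat.fib_add_two (n := k + 2), show k + 2 + 1 = k + 3 by ring]
    omega
  have hs' : s < (Fw k).length := by rwa [length_Fw]
  rw [← getElem_Fw hl, ← getElem_Fw hs']
  have e : (Fw (k + 1)).length = Nat.fib (k + 3) := length_Fw (k + 1)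
  simp only [Fw]
  rw [List.getElem_append_right (by omega)]
  congr 1
  omega

/-- Every `p ≥ 2` splits off its largest Fibonacci number. -/
theorem exists_eq_fib_add (p : ℕ) (hp : 2 ≤ p) :
    ∃ j s, s < Nat.fib (j + 2) ∧ p = Nat.fib (j + 3) + s := by
  induction p, hp using Nat.le_induction with
  | base => exact ⟨0, 0, by decide, by decide⟩
  | succ p _ ih =>
    obtain ⟨j, s, hs, rfl⟩ := ih
    rcases Nat.lt_or_ge (s + 1) (Nat.fib (j + 2)) with h | h
    · exact ⟨j, s + 1, h, by ring⟩
    · refine ⟨j + 1, 0, Nat.fib_pos.2 (by omega), ?_⟩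
      have := Nat.fib_add_two (n := j + 2)
      rw [show j + 2 + 1 = j + 3 by ring] at this
      rw [show j + 1 + 3 = j + 2 + 2 by ring]
      omega

theorem fw_succ_of_true (p : ℕ) : fw p = true → fw (p + 1) = false := by
  induction p using Nat.strong_induction_on with
  | _ p ih =>
    rcases Nat.lt_or_ge p 2 with h | h
    · interval_cases p <;> decide
    · obtain ⟨j, s, hs, rfl⟩ := exists_eq_fib_add p h
      have hpos := Nat.fib_pos.2 (show 0 < j + 3 by omega)
      rw [fw_fib_add j s hs, add_assoc]
      rcases Nat.lt_or_ge (s + 1) (Nat.fib (j + 2)) with h' | h'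
      · rw [fw_fib_add j _ h']
        exact ih s (by omega)
      · intro _
        have e := Nat.fib_add_two (n := j + 2)
        rw [show j + 2 + 1 = j + 3 by ring] at e
        have := fw_fib_add (j + 1) 0 (Nat.fib_pos.2 (by omega))
        rw [show Nat.fib (j + 3) + (s + 1) = Nat.fib (j + 1 + 3) + 0 by
          rw [show j + 1 + 3 = j + 2 + 2 by ring]; omega, this]
        rfl

/-- The words `F_{k+1} F_k` and `F_k F_{k+1}` agree except in their last two letters. -/
theorem fw_fib_add_near (k : ℕ) : ∀ s,
    (s + 2 < Nat.fib (k + 3) → fw (Nat.fib (k + 2) + s) = fw s) ∧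
    (s + 2 = Nat.fib (k + 3) → fw (Nat.fib (k + 2) + s) ≠ fw s) := by
  induction k with
  | zero =>
    intro s
    refine ⟨fun h => ?_, fun h => ?_⟩
    · have : Nat.fib (0 + 3) = 2 := rfl
      omega
    · obtain rfl : s = 0 := by
        have : Nat.fib (0 + 3) = 2 := rfl
        omega
      decide
  | succ k ih =>
    intro s
    have e := Nat.fib_add_two (n := k + 2)
    have e1 : 2 ≤ Nat.fib (k + 3) := Nat.fib_mono (show 3 ≤ k + 3 by omega)
    rw [show k + 2 + 2 = k + 1 + 3 by ring, show k + 2 + 1 = k + 3 by ring] at e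
    rw [show k + 1 + 2 = k + 3 by ring]
    rcases Nat.lt_or_ge s (Nat.fib (k + 2)) with h | h
    · exact ⟨fun _ => fw_fib_add k s h, fun _ => by omega⟩
    · obtain ⟨u, rfl⟩ := Nat.exists_eq_add_of_le h
      have key : u < Nat.fib (k + 3) →
          fw (Nat.fib (k + 3) + (Nat.fib (k + 2) + u)) = fw u := fun hu => by
        rw [← fw_fib_add (k + 1) u hu, e]
        congr 1
        ring
      refine ⟨fun hu => ?_, fun hu => ?_⟩
      · rw [key (by omega), (ih u).1 (by omega)]
      · rw [key (by omega)]
        exact ((ih u).2 (by omega)).symm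

/-- The length of the image of a letter under the `m`-th power of the Fibonacci morphism. -/
def blockLen (m : ℕ) (x : Bool) : ℕ := if x then Nat.fib (m + 1) else Nat.fib (m + 2)

/-- The length of the image of the length-`p` prefix of the Fibonacci word under the `m`-th
power of the Fibonacci morphism. -/
def blockPos (m p : ℕ) : ℕ := ∑ q ∈ Finset.range p, blockLen m (fw q)

theorem blockPos_zero (m : ℕ) : blockPos m 0 = 0 := rfl

theorem blockPos_succ (m p : ℕ) : blockPos m (p + 1) = blockPos m p + blockLen m (fw p) :=
  Finset.sum_range_succ _ _

theorem blockPos_one (m : ℕ) : blockPos m 1 = Nat.fib (m + 2) := by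
  simp [blockPos, blockLen, fw_zero]

theorem blockLen_pos (m : ℕ) (x : Bool) : 0 < blockLen m x := by
  cases x <;> simp [blockLen]

theorem blockPos_strictMono (m : ℕ) : StrictMono (blockPos m) :=
  strictMono_nat_of_lt_succ fun p => by
    rw [blockPos_succ]
    exact Nat.lt_add_of_pos_right (blockLen_pos m _)

theorem blockPos_fib_add (m j s : ℕ) (hs : s ≤ Nat.fib (j + 2)) :
    blockPos m (Nat.fib (j + 3) + s) = blockPos m (Nat.fib (j + 3)) + blockPos m s := by
  rw [blockPos, Finset.sum_range_add]
  congr 1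
  refine Finset.sum_congr rfl fun q hq => ?_
  rw [fw_fib_add j q (by have := Finset.mem_range.1 hq; omega)]

theorem blockPos_fib (m : ℕ) : ∀ j, blockPos m (Nat.fib (j + 2)) = Nat.fib (j + m + 2)
  | 0 => by simpa using blockPos_one m
  | 1 => by
    change blockPos m 2 = _
    rw [blockPos_succ, blockPos_one, fw_one, show 1 + m + 2 = m + 1 + 2 by ring,
      Nat.fib_add_two (n := m + 1)]
    simp only [blockLen, if_true]
    ring
  | j + 2 => by
    rw [Nat.fib_add_two (n := j + 2), add_comm, blockPos_fib_add m j _ le_rfl,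
      blockPos_fib m (j + 1), blockPos_fib m j,
      show j + 2 + m + 2 = (j + m + 2) + 2 by ring, Nat.fib_add_two (n := j + m + 2),
      show j + 1 + m + 2 = j + m + 2 + 1 by ring]
    ring

/-- The image of a letter under a positive power of the Fibonacci morphism is a prefix of the
Fibonacci word. -/
theorem fw_blockPos_add (m p : ℕ) :
    ∀ t < blockLen (m + 1) (fw p), fw (blockPos (m + 1) p + t) = fw t := by
  induction p using Nat.strong_induction_on with
  | _ p ih =>
    intro t ht
    rcases Nat.lt_or_ge p 2 with h | h
    · interval_cases p
      · rw [blockPos_zero, zero_add]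
      · rw [blockPos_one]
        exact fw_fib_add m t (by simpa [blockLen, fw_one] using ht)
    · obtain ⟨j, s, hs, rfl⟩ := exists_eq_fib_add p h
      have hpos := Nat.fib_pos.2 (show 0 < j + 3 by omega)
      rw [fw_fib_add j s hs] at ht
      have hlt : blockPos (m + 1) s + t < Nat.fib (j + m + 1 + 2) := by
        have := (blockPos_strictMono (m + 1)).monotone (show s + 1 ≤ Nat.fib (j + 2) from hs)
        rw [blockPos_fib, blockPos_succ] at this
        exact lt_of_lt_of_le (by omega) this
      rw [blockPos_fib_add _ _ _ hs.le, show j + 3 = j + 1 + 2 by ring, blockPos_fib, add_assoc,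
        show j + 1 + (m + 1) + 2 = j + m + 1 + 3 by ring, fw_fib_add _ _ hlt]
      exact ih s (by omega) t ht

theorem exists_blockPos_le (m n : ℕ) :
    ∃ p r, r < blockLen m (fw p) ∧ n = blockPos m p + r := by
  induction n with
  | zero => exact ⟨0, 0, blockLen_pos m _, rfl⟩
  | succ n ih =>
    obtain ⟨p, r, hr, rfl⟩ := ih
    rcases Nat.lt_or_ge (r + 1) (blockLen m (fw p)) with h | h
    · exact ⟨p, r + 1, h, by ring⟩
    · refine ⟨p + 1, 0, blockLen_pos m _, ?_⟩
      rw [blockPos_succ]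
      omega

/-- After a block of a letter `a`, the Fibonacci word reads `F_{k+2}`. -/
theorem fw_blockPos_of_false {k p t : ℕ} (hp : fw p = false) (ht : t < Nat.fib (k + 4)) :
    fw (blockPos (k + 1) p + t) = fw t := by
  have e := Nat.fib_add_two (n := k + 2)
  rw [show k + 2 + 2 = k + 4 by ring, show k + 2 + 1 = k + 3 by ring] at e
  have hb : blockLen (k + 1) (fw p) = Nat.fib (k + 3) := by simp [blockLen, hp]
  rcases Nat.lt_or_ge t (Nat.fib (k + 3)) with h | h
  · exact fw_blockPos_add k p t (by rwa [hb])
  · obtain ⟨s, rfl⟩ := Nat.exists_eq_add_of_le h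
    rw [fw_fib_add k s (by omega), ← add_assoc, ← hb, ← blockPos_succ]
    refine fw_blockPos_add k _ s (lt_of_lt_of_le (show s < Nat.fib (k + 2) by omega) ?_)
    rw [blockLen]
    split_ifs
    · exact le_rfl
    · exact Nat.fib_mono (by omega)

/-- From the block of a letter `b` on, the Fibonacci word reads `F_k F_{k+1}`, which has
period `|F_k|` up to its last letter. -/
theorem fw_blockPos_of_true {k p t : ℕ} (hp : fw p = true) (ht : t + 1 < Nat.fib (k + 4)) :
    fw (blockPos (k + 1) p + t) = fw (t % Nat.fib (k + 2)) := by
  have e := Nat.fib_add_two (n := k + 2)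
  rw [show k + 2 + 2 = k + 4 by ring, show k + 2 + 1 = k + 3 by ring] at e
  have e' := Nat.fib_add_two (n := k + 1)
  rw [show k + 1 + 2 = k + 3 by ring, show k + 1 + 1 = k + 2 by ring] at e'
  have hb : blockLen (k + 1) (fw p) = Nat.fib (k + 2) := by simp [blockLen, hp]
  rcases Nat.lt_or_ge t (Nat.fib (k + 2)) with h | h
  · rw [Nat.mod_eq_of_lt h]
    exact fw_blockPos_add k p t (by rwa [hb])
  · obtain ⟨s, rfl⟩ := Nat.exists_eq_add_of_le h
    rw [← add_assoc, Nat.add_mod_left]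
    nth_rewrite 1 [← hb]
    have hb' : blockLen (k + 1) (fw (p + 1)) = Nat.fib (k + 3) := by
      simp [blockLen, fw_succ_of_true p hp]
    rw [← blockPos_succ, fw_blockPos_add k _ s (by omega)]
    rcases Nat.lt_or_ge s (Nat.fib (k + 2)) with h' | h'
    · rw [Nat.mod_eq_of_lt h']
    · obtain ⟨u, rfl⟩ := Nat.exists_eq_add_of_le h'
      have hu : u + 1 < Nat.fib (k + 1) := by omega
      have hle : Nat.fib (k + 1) ≤ Nat.fib (k + 2) := Nat.fib_mono (by omega)
      rw [Nat.add_mod_left, Nat.mod_eq_of_lt (by omega)]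
      cases k with
      | zero => simp at hu
      | succ k => exact fw_fib_add k u (by rw [show k + 2 = k + 1 + 1 by ring]; omega)

/-- `F_{k+1} F_k` agrees with the period-`|F_k|` word except in its last two letters. -/
theorem fw_mod_near {k t : ℕ} :
    (t + 2 < Nat.fib (k + 4) → fw t = fw (t % Nat.fib (k + 2))) ∧
    (t + 2 = Nat.fib (k + 4) → fw t ≠ fw (t % Nat.fib (k + 2))) := by
  have e := Nat.fib_add_two (n := k + 2)
  rw [show k + 2 + 2 = k + 4 by ring, show k + 2 + 1 = k + 3 by ring] at e
  have e1 : 2 ≤ Nat.fib (k + 3) := Nat.fib_mono (show 3 ≤ k + 3 by omega)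
  rcases Nat.lt_or_ge t (Nat.fib (k + 2)) with h | h
  · exact ⟨fun _ => by rw [Nat.mod_eq_of_lt h], fun _ => by omega⟩
  · have hs : t + 2 ≤ Nat.fib (k + 4) → fw (t - Nat.fib (k + 2)) = fw (t % Nat.fib (k + 2)) := by
      intro ht
      obtain ⟨s, rfl⟩ := Nat.exists_eq_add_of_le h
      have h1 := fw_blockPos_of_true (k := k) (p := 1) fw_one (t := Nat.fib (k + 2) + s) (by omega)
      have hb : blockPos (k + 1) 1 + Nat.fib (k + 2) = blockPos (k + 1) 2 := by
        rw [blockPos_succ _ 1, fw_one]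
        rfl
      rw [← h1, ← add_assoc, hb, Nat.add_sub_cancel_left]
      exact (fw_blockPos_of_false rfl (by omega)).symm
    obtain ⟨s, rfl⟩ := Nat.exists_eq_add_of_le h
    rw [Nat.add_sub_cancel_left] at hs
    refine ⟨fun ht => ?_, fun ht => ?_⟩
    · rw [← hs ht.le]
      exact (fw_fib_add_near k s).1 (by omega)
    · rw [← hs ht.le]
      exact (fw_fib_add_near k s).2 (by omega)

theorem sum_range_add_of_periodic {g : ℕ → ℕ} {n : ℕ} (hg : Function.Periodic g n) (i : ℕ) :
    ∑ t ∈ Finset.range n, g (i + t) = ∑ t ∈ Finset.range n, g t := by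
  induction i with
  | zero => simp
  | succ i ih =>
    rw [← ih]
    have h := Finset.sum_range_succ (fun t => g (i + t)) n
    rw [Finset.sum_range_succ', hg i, add_zero] at h
    simpa [add_assoc, add_comm 1] using h

theorem sum_range_mul_of_periodic {g : ℕ → ℕ} {n : ℕ} (hg : Function.Periodic g n) (d : ℕ) :
    ∑ t ∈ Finset.range (d * n), g t = d * ∑ t ∈ Finset.range n, g t := by
  induction d with
  | zero => simp
  | succ d ih =>
    rw [Nat.succ_mul, Finset.sum_range_add, ih, sum_range_add_of_periodic hg]
    ring

/-- The indicator of the letter `a`. -/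
def aInd (x : Bool) : ℕ := if x then 0 else 1

theorem aInd_injective : Function.Injective aInd := by decide

theorem sum_aInd_fw : ∀ k, ∑ t ∈ Finset.range (Nat.fib (k + 2)), aInd (fw t) = Nat.fib (k + 1)
  | 0 => rfl
  | 1 => rfl
  | k + 2 => by
    have h : ∑ t ∈ Finset.range (Nat.fib (k + 2)), aInd (fw (Nat.fib (k + 3) + t))
        = Nat.fib (k + 1) := by
      rw [← sum_aInd_fw k]
      exact Finset.sum_congr rfl fun q hq => by rw [fw_fib_add k q (Finset.mem_range.1 hq)]
    rw [Nat.fib_add_two (n := k + 2), add_comm, Finset.sum_range_add, sum_aInd_fw (k + 1), h]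
    exact (add_comm _ _).trans Nat.fib_add_two.symm

theorem periodic_fw_mod (n : ℕ) : Function.Periodic (fun t => aInd (fw (t % n))) n := by
  intro t
  simp

theorem sum_aInd_fw_mod (k i : ℕ) :
    ∑ t ∈ Finset.range (Nat.fib (k + 2)), aInd (fw ((i + t) % Nat.fib (k + 2)))
      = Nat.fib (k + 1) := by
  rw [sum_range_add_of_periodic (periodic_fw_mod (Nat.fib (k + 2))) i, ← sum_aInd_fw k]
  exact Finset.sum_congr rfl fun t ht => by rw [Nat.mod_eq_of_lt (Finset.mem_range.1 ht)]

/-- `F_k` is primitive: its conjugates are pairwise distinct. -/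
theorem eq_of_fw_mod_eq {k r i : ℕ} (hri : r ≤ i) (hi : i < Nat.fib (k + 2))
    (h : ∀ t < Nat.fib (k + 2),
      fw ((r + t) % Nat.fib (k + 2)) = fw ((i + t) % Nat.fib (k + 2))) : r = i := by
  obtain ⟨d, rfl⟩ := Nat.exists_eq_add_of_le hri
  set n := Nat.fib (k + 2) with hn
  have hn0 : 0 < n := by omega
  have hall : ∀ t, fw ((r + t) % n) = fw ((r + d + t) % n) := fun t => by
    have := h (t % n) (Nat.mod_lt _ hn0)
    simpa using this
  have hd : Function.Periodic (fun t => aInd (fw (t % n))) d := fun t => by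
    have := hall (t + (n - r))
    rw [show r + (t + (n - r)) = t + n by omega,
      show r + d + (t + (n - r)) = t + d + n by omega, Nat.add_mod_right, Nat.add_mod_right] at this
    simp only [this]
  have e1 := sum_range_mul_of_periodic (periodic_fw_mod n) d
  have e2 := sum_range_mul_of_periodic hd n
  have e3 := sum_aInd_fw_mod k 0
  simp only [zero_add, ← hn] at e3
  rw [mul_comm, e2, e3] at e1
  have hdvd : n ∣ d :=
    (Nat.fib_coprime_fib_succ (k + 1)).symm.dvd_of_dvd_mul_right ⟨_, e1.symm⟩
  have := Nat.eq_zero_of_dvd_of_lt hdvd (by omega)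
  omega

theorem conj_eq_rotate (i : ℕ) (w : List Bool) : conj i w = w.rotate i :=
  List.rotate_eq_drop_append_take_mod.symm

theorem length_conj_Fw (i k : ℕ) : (conj i (Fw k)).length = Nat.fib (k + 2) := by
  rw [conj_eq_rotate, List.length_rotate, length_Fw]

theorem seg_eq_conj_Fw_iff (i k x : ℕ) : seg x (Nat.fib (k + 2)) = conj i (Fw k) ↔
    ∀ t < Nat.fib (k + 2), fw (x + t) = fw ((i + t) % Nat.fib (k + 2)) := by
  have hl := length_Fw k
  have h0 : 0 < Nat.fib (k + 2) := Nat.fib_pos.2 (by omega)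
  rw [conj_eq_rotate, List.ext_getElem_iff]
  simp only [seg, List.length_map, List.length_range, List.length_rotate, hl, List.getElem_map,
    List.getElem_range, List.getElem_rotate, getElem_Fw, true_and]
  exact ⟨fun h t ht => by rw [h t ht ht, add_comm], fun h t ht _ => by rw [h t ht, add_comm]⟩

theorem occursAt_conj_Fw_iff (i k x : ℕ) : OccursAt (conj i (Fw k)) x ↔
    ∀ t < Nat.fib (k + 2), fw (x + t) = fw ((i + t) % Nat.fib (k + 2)) := by
  rw [OccursAt, length_conj_Fw, seg_eq_conj_Fw_iff]

theorem occursAt_blockPos_add {k i : ℕ} (p : ℕ) (hi : i + 1 ≤ Nat.fib (k + 2)) :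
    OccursAt (conj i (Fw k)) (blockPos (k + 1) p + i) := by
  rw [occursAt_conj_Fw_iff]
  intro t ht
  have e := Nat.fib_add_two (n := k + 2)
  rw [show k + 2 + 2 = k + 4 by ring, show k + 2 + 1 = k + 3 by ring] at e
  have e' := Nat.fib_add_two (n := k + 1)
  rw [show k + 1 + 2 = k + 3 by ring, show k + 1 + 1 = k + 2 by ring] at e'
  have hpos := Nat.fib_pos.2 (show 0 < k + 1 by omega)
  rw [add_assoc]
  cases hp : fw p with
  | false =>
    rw [fw_blockPos_of_false hp (by omega)]
    exact fw_mod_near.1 (by omega)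
  | true => exact fw_blockPos_of_true hp (by omega)

theorem exists_of_occursAt {k i x : ℕ} (h1 : Nat.fib (k + 1) ≤ i + 1)
    (h2 : i + 1 ≤ Nat.fib (k + 2)) (h : OccursAt (conj i (Fw k)) x) :
    ∃ p, blockPos (k + 1) p + i = x := by
  rw [occursAt_conj_Fw_iff] at h
  obtain ⟨p, r, hr, rfl⟩ := exists_blockPos_le (k + 1) x
  refine ⟨p, congrArg _ ?_⟩
  simp only [add_assoc] at h
  have e := Nat.fib_add_two (n := k + 2)
  rw [show k + 2 + 2 = k + 4 by ring, show k + 2 + 1 = k + 3 by ring] at e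
  have e' := Nat.fib_add_two (n := k + 1)
  rw [show k + 1 + 2 = k + 3 by ring, show k + 1 + 1 = k + 2 by ring] at e'
  have hpos := Nat.fib_pos.2 (show 0 < k + 1 by omega)
  have hle : Nat.fib (k + 1) ≤ Nat.fib (k + 2) := Nat.fib_mono (by omega)
  have prim : ∀ r' < Nat.fib (k + 2), (∀ t < Nat.fib (k + 2),
      fw ((r' + t) % Nat.fib (k + 2)) = fw ((i + t) % Nat.fib (k + 2))) → i = r' := by
    intro r' hr' hrot
    rcases le_total r' i with hle' | hle'
    · exact (eq_of_fw_mod_eq hle' (by omega) hrot).symm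
    · exact eq_of_fw_mod_eq hle' hr' fun t ht => (hrot t ht).symm
  cases hp : fw p with
  | true =>
    have hr' : r < Nat.fib (k + 2) := by simpa [blockLen, hp] using hr
    refine prim r hr' fun t ht => ?_
    rw [← h t ht, fw_blockPos_of_true hp (by omega)]
  | false =>
    have hr' : r < Nat.fib (k + 3) := by simpa [blockLen, hp] using hr
    have hw : ∀ t < Nat.fib (k + 2), fw (r + t) = fw ((i + t) % Nat.fib (k + 2)) := fun t ht => by
      rw [← h t ht, fw_blockPos_of_false hp (by omega)]
    rcases Nat.lt_or_ge (r + 1) (Nat.fib (k + 3)) with hr2 | hr2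
    · have hrot : ∀ t < Nat.fib (k + 2),
          fw ((r + t) % Nat.fib (k + 2)) = fw ((i + t) % Nat.fib (k + 2)) := fun t ht => by
        rw [← hw t ht]
        exact (fw_mod_near.1 (by omega)).symm
      rcases Nat.lt_or_ge r (Nat.fib (k + 2)) with hr3 | hr3
      · exact prim r hr3 hrot
      · obtain ⟨u, rfl⟩ := Nat.exists_eq_add_of_le hr3
        have := prim u (by omega) fun t ht => by
          rw [← hrot t ht, add_assoc, Nat.add_mod_left]
        omega
    · exfalso
      obtain ⟨N, hN⟩ : ∃ N, Nat.fib (k + 2) = N + 1 := ⟨Nat.fib (k + 2) - 1, by omega⟩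
      have s1 := sum_aInd_fw_mod k i
      have s2 := sum_aInd_fw_mod k r
      rw [← Finset.sum_congr rfl fun t ht => congrArg aInd (hw t (Finset.mem_range.1 ht))] at s1
      rw [← s2] at s1
      nth_rewrite 1 [hN] at s1
      rw [show Finset.range (Nat.fib (k + 2)) = Finset.range (N + 1) by rw [hN],
        Finset.sum_range_succ, Finset.sum_range_succ] at s1
      have s3 : ∑ t ∈ Finset.range N, aInd (fw (r + t))
          = ∑ t ∈ Finset.range N, aInd (fw ((r + t) % Nat.fib (k + 2))) :=
        Finset.sum_congr rfl fun t ht => congrArg aInd <|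
          fw_mod_near.1 (by have := Finset.mem_range.1 ht; omega)
      rw [s3] at s1
      exact (fw_mod_near (k := k)).2 (by omega) (aInd_injective (Nat.add_left_cancel s1))

theorem occPos_conj_Fw {k i : ℕ} (h1 : Nat.fib (k + 1) ≤ i + 1)
    (h2 : i + 1 ≤ Nat.fib (k + 2)) (p : ℕ) :
    occPos (conj i (Fw k)) p = blockPos (k + 1) p + i := by
  have hmono : StrictMono fun p => blockPos (k + 1) p + i := fun a b hab =>
    Nat.add_lt_add_right (blockPos_strictMono (k + 1) hab) i
  have hall : ∀ p, OccursAt (conj i (Fw k)) (blockPos (k + 1) p + i) := fun p =>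
    occursAt_blockPos_add p h2
  have hinf : ¬ {x | OccursAt (conj i (Fw k)) x}.Finite := fun hfin =>
    Set.infinite_of_injective_forall_mem hmono.injective hall hfin
  have := Nat.nth_comp_of_strictMono (n := p) hmono
    (fun x hx => exists_of_occursAt h1 h2 hx) (fun hfin => absurd hfin hinf)
  rw [occPos, ← this]
  simp [hall]

/-- let `ω ∈ T1.2`, i.e. `ω = C_i(F_k)` with `f_{k-1}-1 ≤ i ≤ f_k-1`.
Then `ν_{ω,1} = C_j(F_{k-1})` with `j ≡ i - f_{k-1} ≡ i (mod f_{k-1})` (a nonempty word of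
length `f_{k-1}`: for `p` with `F_∞[p] = a`, consecutive occurrences are separated),
and `ν_{ω,2} = ε` (for `p` with `F_∞[p] = b`, consecutive occurrences are adjacent,
i.e. `ω²` occurs). -/
theorem stmt15 (k : ℕ) (hk : 1 ≤ k) (i : ℕ)
    (h1 : Nat.fib (k+1) ≤ i + 1) (h2 : i + 1 ≤ Nat.fib (k+2)) :
    gap (conj i (Fw k)) 0 = listToFree (conj i (Fw (k-1))) ∧
    gap (conj i (Fw k)) 1 = 1 ∧
    (∀ p : ℕ, fw p = false →
      occPos (conj i (Fw k)) (p+1)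
        = occPos (conj i (Fw k)) p + (conj i (Fw k)).length + Nat.fib (k+1)) ∧
    (∀ p : ℕ, fw p = true →
      occPos (conj i (Fw k)) (p+1)
        = occPos (conj i (Fw k)) p + (conj i (Fw k)).length) := by
  have hl := length_conj_Fw i k
  have hocc := occPos_conj_Fw h1 h2
  have e := Nat.fib_add_two (n := k + 1)
  rw [show k + 1 + 2 = k + 1 + 1 + 1 by ring, show k + 1 + 1 = k + 2 by ring] at e
  have ha : ∀ p : ℕ, fw p = false →
      occPos (conj i (Fw k)) (p+1)
        = occPos (conj i (Fw k)) p + (conj i (Fw k)).length + Nat.fib (k+1) := fun p hp => by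
    rw [hocc, hocc, hl, blockPos_succ, hp]
    simp only [blockLen]
    rw [show k + 1 + 2 = k + 2 + 1 by ring, e]
    simp
    ring
  have hb : ∀ p : ℕ, fw p = true →
      occPos (conj i (Fw k)) (p+1)
        = occPos (conj i (Fw k)) p + (conj i (Fw k)).length := fun p hp => by
    rw [hocc, hocc, hl, blockPos_succ, hp]
    simp only [blockLen, if_true]
    ring
  refine ⟨?_, ?_, ha, hb⟩
  · rw [gap, ha 0 fw_zero, if_pos (Nat.le_add_right _ _), Nat.add_sub_cancel_left, hocc, hl,
      blockPos_zero, zero_add]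
    obtain ⟨m, rfl⟩ := Nat.exists_eq_add_of_le' hk
    congr 1
    refine (seg_eq_conj_Fw_iff i m _).2 fun t ht => ?_
    have := fw_blockPos_of_true (k := m) (p := 1) fw_one (t := i + t) ?_
    · rw [← this, blockPos_one]
      congr 1
      ring
    · have e2 := Nat.fib_add_two (n := m + 2)
      simp only [show m + 2 + 2 = m + 4 by ring, show m + 2 + 1 = m + 3 by ring] at e2
      simp only [show m + 1 + 2 = m + 3 by ring] at h2
      omega
  · rw [gap, hb 1 fw_one, if_pos le_rfl, Nat.sub_self]
    rfl
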